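/- Let H be a finite-index subgroup of ℤ × ℤ whose quotient (ℤ × ℤ)/H is cyclic, let β₁, …, β_n be finitely many primitive elements of ℤ × ℤ, and let L be a positive integer. Then there exists an infinite set S of primitive elements of ℤ × ℤ contained in H, no two of which are parallel, such that every γ ∈ S satisfies |γ₁·(β_i)₂ − γ₂·(β_i)₁| ≥ L for each i = 1, …, n. -/

import Mathlib

/-- A subgroup of `ℤ × ℤ` with cyclic quotient contains a primitive element. -/
theorem exists_isCoprime_mem_of_isAddCyclic_quotient (H : AddSubgroup (ℤ × ℤ))
    (hcyc : IsAddCyclic ((ℤ × ℤ) ⧸ H)) : ∃ u v : ℤ, IsCoprime u v ∧ (u, v) ∈ H := by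
  obtain ⟨g, hg⟩ := hcyc.exists_generator
  obtain ⟨a, ha⟩ := AddSubgroup.mem_zmultiples_iff.mp (hg (((1, 0) : ℤ × ℤ) : (ℤ × ℤ) ⧸ H))
  obtain ⟨b, hb⟩ := AddSubgroup.mem_zmultiples_iff.mp (hg (((0, 1) : ℤ × ℤ) : (ℤ × ℤ) ⧸ H))
  have mem_of_eq (x y : ℤ) (h : x * a + y * b = 0) : (x, y) ∈ H := by
    rw [← QuotientAddGroup.eq_zero_iff]
    have hxy : ((x, y) : ℤ × ℤ) = x • ((1, 0) : ℤ × ℤ) + y • ((0, 1) : ℤ × ℤ) := by simp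
    rw [hxy, QuotientAddGroup.mk_add, QuotientAddGroup.mk_zsmul, QuotientAddGroup.mk_zsmul,
      ← ha, ← hb, smul_smul, smul_smul, ← add_zsmul, h, zero_zsmul]
  by_cases hab : Int.gcd a b = 0
  · obtain ⟨rfl, rfl⟩ := Int.gcd_eq_zero_iff.mp hab
    exact ⟨1, 0, isCoprime_one_left, mem_of_eq 1 0 (by simp)⟩
  · obtain ⟨a', b', hcop, ha', hb'⟩ := Int.exists_gcd_one (Nat.pos_of_ne_zero hab)
    refine ⟨b', -a', (Int.isCoprime_iff_gcd_eq_one.mpr hcop).symm.neg_right, mem_of_eq _ _ ?_⟩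
    linear_combination b' * ha' - a' * hb'

/-- If no index has `c i = d i = 0`, some integer `t` makes every `c i + t * d i` nonzero. -/
theorem exists_forall_add_mul_ne_zero {ι : Type*} [Fintype ι] (c d : ι → ℤ)
    (h : ∀ i, d i = 0 → c i ≠ 0) : ∃ t : ℤ, ∀ i, c i + t * d i ≠ 0 := by
  refine ⟨1 + ∑ j, |c j|, fun i hi => ?_⟩
  have hle : |c i| ≤ ∑ j, |c j| :=
    Finset.single_le_sum (fun j _ => abs_nonneg (c j)) (Finset.mem_univ i)
  have hd : d i ≠ 0 := fun hd => h i hd (by simpa [hd] using hi)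
  have habs : |c i| = (1 + ∑ j, |c j|) * |d i| := by
    rw [eq_neg_of_add_eq_zero_left hi, abs_neg, abs_mul,
      abs_of_nonneg (a := 1 + ∑ j, |c j|) (by linarith [abs_nonneg (c i)])]
  nlinarith [Int.one_le_abs hd, abs_nonneg (c i)]

/-- The numbers `d i + k * e i` with all `e i` nonzero are uniformly large for large `k`. -/
theorem exists_forall_le_abs_add_mul {ι : Type*} [Fintype ι] (d e : ι → ℤ)
    (he : ∀ i, e i ≠ 0) (L : ℤ) :
    ∃ K : ℤ, ∀ k, K ≤ k → ∀ i, L ≤ |d i + k * e i| := by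
  refine ⟨|L| + ∑ j, |d j|, fun k hk i => ?_⟩
  have hle : |d i| ≤ ∑ j, |d j| :=
    Finset.single_le_sum (fun j _ => abs_nonneg (d j)) (Finset.mem_univ i)
  have hk0 : 0 ≤ k := by linarith [abs_nonneg L, abs_nonneg (d i)]
  have habs : |k * e i| ≤ |d i + k * e i| + |d i| := by
    simpa using abs_sub (d i + k * e i) (d i)
  rw [abs_mul, abs_of_nonneg hk0] at habs
  nlinarith [Int.one_le_abs (he i), le_abs_self L]

/-- Let `H` be a finite-index subgroup of `ℤ × ℤ` with cyclic quotient, let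
`β 1, …, β n` be finitely many primitive elements of `ℤ × ℤ`, and let `L > 0`.
Then there is an infinite set `S` of primitive elements of `ℤ × ℤ` contained in `H`,
pairwise non-parallel, each of whose members `γ` satisfies
`|γ₁ (β i)₂ − γ₂ (β i)₁| ≥ L` for all `i`. -/
theorem infinitely_many_lifting_slopes_far_from_exceptional_slopes
    (H : AddSubgroup (ℤ × ℤ)) (hH : H.FiniteIndex)
    (hcyc : IsAddCyclic ((ℤ × ℤ) ⧸ H))
    (n : ℕ) (β : Fin n → ℤ × ℤ) (hβ : ∀ i, Int.gcd (β i).1 (β i).2 = 1)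
    (L : ℕ) (hL : 0 < L) :
    ∃ S : Set (ℤ × ℤ), S.Infinite ∧ S ⊆ (H : Set (ℤ × ℤ)) ∧
      (∀ γ ∈ S, Int.gcd γ.1 γ.2 = 1) ∧
      (∀ γ ∈ S, ∀ γ' ∈ S, γ ≠ γ' → γ.1 * γ'.2 - γ.2 * γ'.1 ≠ 0) ∧
      (∀ γ ∈ S, ∀ i : Fin n, (L : ℤ) ≤ |γ.1 * (β i).2 - γ.2 * (β i).1|) := by
  obtain ⟨u, v, ⟨r, s, hrs⟩, huv⟩ := exists_isCoprime_mem_of_isAddCyclic_quotient H hcyc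
  obtain ⟨t, ht⟩ := exists_forall_add_mul_ne_zero
    (fun i => -s * (β i).2 - r * (β i).1) (fun i => u * (β i).2 - v * (β i).1) (by
      intro i hd hc
      have h₁ : (β i).1 = 0 := by linear_combination (-(β i).1) * hrs - s * hd - u * hc
      have h₂ : (β i).2 = 0 := by linear_combination (-(β i).2) * hrs + r * hd - v * hc
      simpa [h₁, h₂] using hβ i)
  obtain ⟨x, hx⟩ : ∃ x, x = -s + t * u := ⟨_, rfl⟩
  obtain ⟨y, hy⟩ : ∃ y, y = r + t * v := ⟨_, rfl⟩
  have hdet : u * y - v * x = 1 := by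
    rw [hx, hy]
    linear_combination hrs
  have hm : (H.index : ℤ) ≠ 0 := by exact_mod_cast hH.index_ne_zero
  obtain ⟨K, hK⟩ := exists_forall_le_abs_add_mul
    (fun i => u * (β i).2 - v * (β i).1) (fun i => H.index * (x * (β i).2 - y * (β i).1))
    (fun i => mul_ne_zero hm (by
      convert ht i using 1
      rw [hx, hy]
      ring)) L
  let γ : ℤ → ℤ × ℤ := fun k => (u, v) + k • H.index • (x, y)
  have hγ₁ (k : ℤ) : (γ k).1 = u + k * (H.index * x) := by simp [γ]
  have hγ₂ (k : ℤ) : (γ k).2 = v + k * (H.index * y) := by simp [γ]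
  have hγdet (k l : ℤ) : (γ k).1 * (γ l).2 - (γ k).2 * (γ l).1 = (l - k) * H.index := by
    rw [hγ₁, hγ₁, hγ₂, hγ₂]
    linear_combination ((l - k) * H.index) * hdet
  have hγinj : Function.Injective γ := by
    intro k l hkl
    have h := hγdet k l
    rw [hkl, mul_comm, sub_self, eq_comm, mul_eq_zero] at h
    exact (sub_eq_zero.mp (h.resolve_right hm)).symm
  refine ⟨γ '' Set.Ici K, (Set.Ici_infinite K).image hγinj.injOn, ?_, ?_, ?_, ?_⟩
  · rintro _ ⟨k, -, rfl⟩
    exact H.add_mem huv (H.zsmul_mem (H.nsmul_index_mem (x, y)) k)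
  · rintro _ ⟨k, -, rfl⟩
    rw [← Int.isCoprime_iff_gcd_eq_one, hγ₁, hγ₂]
    exact ⟨y, -x, by linear_combination hdet⟩
  · rintro _ ⟨k, -, rfl⟩ _ ⟨l, -, rfl⟩ hne
    rw [hγdet]
    exact mul_ne_zero (sub_ne_zero.mpr fun h => hne (h ▸ rfl)) hm
  · rintro _ ⟨k, hk, rfl⟩ i
    convert hK k hk i using 2
    rw [hγ₁, hγ₂]
    ring
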